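/- arXiv:2512.15487 — 2 statements merged into one kernel-verified Lean document; each statement's English description precedes it below -/
import Mathlib

section
/- For fixed θ ∈ (1/2,1), |m̃(D)^{-1}(χ_ε(D)((χ_ε(D)ζ)(χ_ε(D)ρ)) - ζρ)|_{Y^{1+θ}} ≲ ε^{(1-θ)/2} |ζ|_{Y^{1+θ}} |ρ|_{Y^{1+θ}} for all ζ, ρ ∈ Y^{1+θ}. -/
open MeasureTheory

/-- The anisotropic KP weight `(1 + k₁² + k₂²/k₁²)^r`. -/
noncomputable def wgt (r : ℝ) (k : ℝ × ℝ) : ℝ := (1 + k.1 ^ 2 + k.2 ^ 2 / k.1 ^ 2) ^ r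

/-- The squared `Y^r` norm, computed on the Fourier side. -/
noncomputable def YnormSq (r : ℝ) (g : ℝ × ℝ → ℂ) : ℝ := ∫ k : ℝ × ℝ, wgt r k * ‖g k‖ ^ 2

/-- The KP symbol `m̃(k) = 1 + k₂²/k₁² + ½(β - 1/3)k₁²`. -/
noncomputable def mKP (β : ℝ) (k : ℝ × ℝ) : ℝ :=
  1 + k.2 ^ 2 / k.1 ^ 2 + (1 / 2) * (β - 1 / 3) * k.1 ^ 2

/-- Characteristic function (as a complex scalar) of the cone `C_ε`. -/
noncomputable def chiC (ε δ : ℝ) (k : ℝ × ℝ) : ℂ :=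
  if |k.1| ≤ δ / ε ∧ |k.2 / k.1| ≤ δ / ε then 1 else 0

/-- Convolution on the Fourier side (corresponding to a product in physical space). -/
noncomputable def conv (f g : ℝ × ℝ → ℂ) : ℝ × ℝ → ℂ := fun k => ∫ j : ℝ × ℝ, f j * g (k - j)

lemma wbase_ge_one (k : ℝ × ℝ) : 1 ≤ 1 + k.1 ^ 2 + k.2 ^ 2 / k.1 ^ 2 := by
  have h1 : 0 ≤ k.1 ^ 2 := sq_nonneg _
  have h2 : 0 ≤ k.2 ^ 2 / k.1 ^ 2 := by positivity
  linarith

lemma wgt_pos (r : ℝ) (k : ℝ × ℝ) : 0 < wgt r k :=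
  Real.rpow_pos_of_pos (by linarith [wbase_ge_one k]) _

lemma wgt_measurable (r : ℝ) : Measurable (wgt r) := by
  unfold wgt
  fun_prop

lemma wgt_add (r s : ℝ) (k : ℝ × ℝ) : wgt (r + s) k = wgt r k * wgt s k :=
  Real.rpow_add (by linarith [wbase_ge_one k]) _ _

lemma wgt_zero (k : ℝ × ℝ) : wgt 0 k = 1 := by simp [wgt]

lemma one_le_wgt {r : ℝ} (hr : 0 ≤ r) (k : ℝ × ℝ) : 1 ≤ wgt r k :=
  Real.one_le_rpow (wbase_ge_one k) hr

/-- Integrability of the reciprocal weight. -/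
lemma wgt_neg_integrable (θ : ℝ) (hθ : 1 / 2 < θ) :
    Integrable (fun k : ℝ × ℝ => wgt (-(1 + θ)) k) := by
  set a : ℝ := 1 + (θ - 1 / 2) / 2 with ha
  set b : ℝ := 1 / 2 + (θ - 1 / 2) / 2 with hb
  have hI : ∀ r : ℝ, 1 / 2 < r → Integrable (fun x : ℝ => (1 + x ^ 2) ^ (-r)) := by
    intro r hr
    have := integrable_rpow_neg_one_add_norm_sq (E := ℝ) (μ := volume) (r := 2 * r)
      (by simp; linarith)
    refine this.congr (Filter.Eventually.of_forall fun x => ?_)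
    simp only [Real.norm_eq_abs, sq_abs]
    congr 1
    ring
  have hmeas : AEStronglyMeasurable
      (fun k : ℝ × ℝ => (1 + k.1 ^ 2) ^ (-a) * (1 + (k.2 / k.1) ^ 2) ^ (-b))
      ((volume : Measure ℝ).prod (volume : Measure ℝ)) := by
    apply Measurable.aestronglyMeasurable
    fun_prop
  have hmain : Integrable
      (fun k : ℝ × ℝ => (1 + k.1 ^ 2) ^ (-a) * (1 + (k.2 / k.1) ^ 2) ^ (-b))
      ((volume : Measure ℝ).prod (volume : Measure ℝ)) := by
    rw [integrable_prod_iff hmeas]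
    constructor
    · have h0 : ∀ᵐ x : ℝ, x ≠ 0 := by
        simp [ae_iff]
      filter_upwards [h0] with x hx
      exact ((hI b (by rw [hb]; linarith)).comp_div hx).const_mul _
    · have hEq : (fun x : ℝ => ∫ y : ℝ, ‖(1 + x ^ 2) ^ (-a) * (1 + (y / x) ^ 2) ^ (-b)‖) =
          fun x : ℝ => ((1 + x ^ 2) ^ (-a) * |x|) * ∫ y : ℝ, (1 + y ^ 2) ^ (-b) := by
        funext x
        have h1 : ∀ y : ℝ, ‖(1 + x ^ 2) ^ (-a) * (1 + (y / x) ^ 2) ^ (-b)‖ =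
            (1 + x ^ 2) ^ (-a) * (1 + (y / x) ^ 2) ^ (-b) := fun y =>
          Real.norm_of_nonneg (by positivity)
        simp_rw [h1]
        rw [integral_const_mul, Measure.integral_comp_div (fun s : ℝ => (1 + s ^ 2) ^ (-b)) x,
          smul_eq_mul, mul_assoc]
      simp only at hEq ⊢
      rw [hEq]
      apply Integrable.mul_const
      refine (hI (a - 1 / 2) (by rw [ha]; linarith)).mono' (by fun_prop) ?_
      refine Filter.Eventually.of_forall fun x => ?_
      rw [Real.norm_of_nonneg (by positivity)]
      have hp : (0 : ℝ) < 1 + x ^ 2 := by positivity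
      have : -(a - 1 / 2) = -a + 1 / 2 := by ring
      rw [this, Real.rpow_add hp, ← Real.sqrt_eq_rpow]
      apply mul_le_mul_of_nonneg_left _ (by positivity)
      apply Real.abs_le_sqrt
      linarith
  have hmain' : Integrable
      (fun k : ℝ × ℝ => (1 + k.1 ^ 2) ^ (-a) * (1 + (k.2 / k.1) ^ 2) ^ (-b)) := hmain
  refine hmain'.mono' (wgt_measurable _).aestronglyMeasurable ?_
  refine Filter.Eventually.of_forall fun k => ?_
  rw [Real.norm_of_nonneg (wgt_pos _ _).le]
  have hab : -(1 + θ) = -a + -b := by rw [ha, hb]; ring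
  rw [hab, wgt_add]
  have h1 : 0 ≤ k.1 ^ 2 := sq_nonneg _
  have h2 : 0 ≤ (k.2 / k.1) ^ 2 := sq_nonneg _
  have h3 : k.2 ^ 2 / k.1 ^ 2 = (k.2 / k.1) ^ 2 := by rw [div_pow]
  unfold wgt
  rw [h3]
  apply mul_le_mul
  · apply Real.rpow_le_rpow_of_nonpos (by positivity) (by linarith)
    rw [ha]; linarith
  · apply Real.rpow_le_rpow_of_nonpos (by positivity) (by linarith)
    rw [hb]; linarith
  · positivity
  · positivity

/-- Cauchy-Schwarz for lower integrals. -/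
lemma lintegral_cs {α : Type*} [MeasurableSpace α] (μ : Measure α) {p q : α → ENNReal}
    (hp : Measurable p) (hq : Measurable q) :
    (∫⁻ x, p x * q x ∂μ) ^ 2 ≤ (∫⁻ x, p x ^ 2 ∂μ) * ∫⁻ x, q x ^ 2 ∂μ := by
  have h := ENNReal.lintegral_mul_le_Lp_mul_Lq μ (p := 2) (q := 2)
    (Real.HolderConjugate.two_two) hp.aemeasurable hq.aemeasurable
  simp only [Pi.mul_apply] at h
  have h2 := pow_le_pow_left' h 2
  rw [mul_pow, ← ENNReal.rpow_natCast, ← ENNReal.rpow_natCast, ← ENNReal.rpow_natCast,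
    ← ENNReal.rpow_mul, ← ENNReal.rpow_mul] at h2
  simpa using h2

/-- Young's inequality `L¹ * L² ⊆ L²`. -/
lemma young12 {P Q : ℝ × ℝ → ENNReal} (hP : Measurable P) (hQ : Measurable Q) :
    ∫⁻ k, (∫⁻ j, P j * Q (k - j)) ^ 2 ≤ (∫⁻ j, P j) ^ 2 * ∫⁻ j, Q j ^ 2 := by
  have h1 : ∀ k : ℝ × ℝ, (∫⁻ j, P j * Q (k - j)) ^ 2 ≤
      (∫⁻ j, P j) * ∫⁻ j, P j * Q (k - j) ^ 2 := by
    intro k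
    have hs : ∀ x : ENNReal, (x ^ (1 / 2 : ℝ)) ^ 2 = x := by
      intro x
      rw [← ENNReal.rpow_natCast, ← ENNReal.rpow_mul]
      simp
    have := lintegral_cs (volume : Measure (ℝ × ℝ)) (p := fun j => P j ^ (1 / 2 : ℝ))
      (q := fun j => P j ^ (1 / 2 : ℝ) * Q (k - j)) (by fun_prop) (by fun_prop)
    simp only [mul_pow, ← mul_assoc, ← pow_two, hs] at this
    exact this
  calc ∫⁻ k, (∫⁻ j, P j * Q (k - j)) ^ 2
      ≤ ∫⁻ k, (∫⁻ j, P j) * ∫⁻ j, P j * Q (k - j) ^ 2 := lintegral_mono h1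
    _ = (∫⁻ j, P j) * ∫⁻ k, ∫⁻ j, P j * Q (k - j) ^ 2 := by
        rw [lintegral_const_mul]
        apply Measurable.lintegral_prod_right'
          (f := fun z : (ℝ × ℝ) × (ℝ × ℝ) => P z.2 * Q (z.1 - z.2) ^ 2)
        fun_prop
    _ = (∫⁻ j, P j) * ∫⁻ j, ∫⁻ k, P j * Q (k - j) ^ 2 := by
        rw [lintegral_lintegral_swap]
        apply Measurable.aemeasurable
        simp only [Function.uncurry_def]
        fun_prop
    _ = (∫⁻ j, P j) * ∫⁻ j, P j * ∫⁻ k, Q k ^ 2 := by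
        congr 1
        apply lintegral_congr
        intro j
        rw [lintegral_const_mul _ (by fun_prop),
          lintegral_sub_right_eq_self (fun k => Q k ^ 2) j]
    _ = (∫⁻ j, P j) ^ 2 * ∫⁻ j, Q j ^ 2 := by
        rw [lintegral_mul_const _ hP, pow_two, mul_assoc]

/-- The weighted modulus. -/
noncomputable def tw (θ : ℝ) (f : ℝ × ℝ → ℂ) (k : ℝ × ℝ) : ENNReal :=
  ENNReal.ofReal (wgt ((1 + θ) / 2) k) * ‖f k‖ₑ

lemma tw_measurable (θ : ℝ) {f : ℝ × ℝ → ℂ} (hf : Measurable f) : Measurable (tw θ f) := by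
  unfold tw
  exact (wgt_measurable _).ennreal_ofReal.mul hf.enorm

lemma enorm_le_tw {θ : ℝ} (hθ : 0 ≤ θ) (f : ℝ × ℝ → ℂ) (k : ℝ × ℝ) : ‖f k‖ₑ ≤ tw θ f k := by
  unfold tw
  have : 1 ≤ ENNReal.ofReal (wgt ((1 + θ) / 2) k) := by
    rw [ENNReal.one_le_ofReal]
    exact one_le_wgt (by linarith) k
  calc ‖f k‖ₑ = 1 * ‖f k‖ₑ := (one_mul _).symm
    _ ≤ _ := by gcongr

lemma lintegral_tw_sq (θ : ℝ) {f : ℝ × ℝ → ℂ}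
    (hf : Integrable (fun k => wgt (1 + θ) k * ‖f k‖ ^ 2)) :
    ∫⁻ k, tw θ f k ^ 2 = ENNReal.ofReal (YnormSq (1 + θ) f) := by
  unfold YnormSq
  rw [ofReal_integral_eq_lintegral_ofReal hf]
  · apply lintegral_congr
    intro k
    unfold tw
    rw [mul_pow, ← ENNReal.ofReal_pow (wgt_pos _ _).le, ← ofReal_norm,
      ← ENNReal.ofReal_pow (norm_nonneg _), ← ENNReal.ofReal_mul (sq_nonneg _), pow_two (wgt _ _),
      ← wgt_add]
    congr 3
    ring
  · exact Filter.Eventually.of_forall fun k => mul_nonneg (wgt_pos _ _).le (sq_nonneg _)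

lemma lintegral_enorm_sq (θ : ℝ) (hθ : 1 / 2 < θ) {f : ℝ × ℝ → ℂ} (hfm : Measurable f)
    (hf : Integrable (fun k => wgt (1 + θ) k * ‖f k‖ ^ 2)) :
    (∫⁻ k, ‖f k‖ₑ) ^ 2 ≤ ENNReal.ofReal (∫ k, wgt (-(1 + θ)) k) *
      ENNReal.ofReal (YnormSq (1 + θ) f) := by
  have h := lintegral_cs (volume : Measure (ℝ × ℝ))
    (p := fun k => ENNReal.ofReal (wgt (-(1 + θ) / 2) k)) (q := tw θ f)
    (wgt_measurable _).ennreal_ofReal (tw_measurable θ hfm)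
  rw [lintegral_tw_sq θ hf] at h
  have e1 : ∀ k, ENNReal.ofReal (wgt (-(1 + θ) / 2) k) * tw θ f k = ‖f k‖ₑ := by
    intro k
    unfold tw
    rw [← mul_assoc, ← ENNReal.ofReal_mul (wgt_pos _ _).le, ← wgt_add]
    have : -(1 + θ) / 2 + (1 + θ) / 2 = 0 := by ring
    rw [this, wgt_zero]
    simp
  have e2 : ∀ k, ENNReal.ofReal (wgt (-(1 + θ) / 2) k) ^ 2 = ENNReal.ofReal (wgt (-(1 + θ)) k) := by
    intro k
    rw [← ENNReal.ofReal_pow (wgt_pos _ _).le, pow_two, ← wgt_add]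
    congr 2
    ring
  simp_rw [e1, e2] at h
  rw [ofReal_integral_eq_lintegral_ofReal (wgt_neg_integrable θ hθ)
    (Filter.Eventually.of_forall fun k => (wgt_pos _ _).le)]
  exact h

/-- Smallness of negative powers of the weight off the cone. -/
lemma wgt_small {ε δ s t : ℝ} (hδ : 0 < δ) (hδ1 : δ < 1) (hε : 0 < ε) (hε1 : ε < 1)
    (ht : 0 ≤ t) (hst : t ≤ 2 * s) (hs1 : s ≤ 1) (k : ℝ × ℝ)
    (hk : ¬ (|k.1| ≤ δ / ε ∧ |k.2 / k.1| ≤ δ / ε)) :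
    wgt (-s) k ≤ (δ⁻¹) ^ 2 * ε ^ t := by
  have hq : 0 < δ / ε := by positivity
  have hw : (δ / ε) ^ 2 ≤ 1 + k.1 ^ 2 + k.2 ^ 2 / k.1 ^ 2 := by
    have h1 : 0 ≤ k.1 ^ 2 := sq_nonneg _
    have h2 : 0 ≤ (k.2 / k.1) ^ 2 := sq_nonneg _
    rw [← div_pow]
    by_cases h : |k.1| ≤ δ / ε
    · have h' : δ / ε < |k.2 / k.1| := by
        by_contra hc
        exact hk ⟨h, not_lt.mp hc⟩
      have := pow_le_pow_left₀ hq.le h'.le 2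
      rw [sq_abs] at this
      linarith
    · have := pow_le_pow_left₀ hq.le (not_le.mp h).le 2
      rw [sq_abs] at this
      linarith
  have h1 : wgt (-s) k ≤ ((δ / ε) ^ 2) ^ (-s) :=
    Real.rpow_le_rpow_of_nonpos (by positivity) hw (by linarith)
  have h2 : ((δ / ε) ^ 2) ^ (-s) = (δ⁻¹) ^ (2 * s) * ε ^ (2 * s) := by
    rw [← Real.rpow_natCast, ← Real.rpow_mul hq.le, ← Real.mul_rpow (by positivity) hε.le]
    have : δ⁻¹ * ε = (δ / ε)⁻¹ := by rw [inv_div]; ring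
    rw [this, Real.inv_rpow hq.le, ← Real.rpow_neg hq.le]
    congr 1
    push_cast
    ring
  rw [h2] at h1
  refine h1.trans (mul_le_mul ?_ ?_ (by positivity) (by positivity))
  · rw [← Real.rpow_natCast]
    apply Real.rpow_le_rpow_of_exponent_le
    · exact (one_le_inv₀ hδ).mpr hδ1.le
    · push_cast; linarith
  · exact Real.rpow_le_rpow_of_exponent_ge hε hε1.le hst

lemma enorm_le_small_tw {ε δ θ η : ℝ} (hη : η = (δ⁻¹) ^ 2 * ε ^ ((1 - θ) / 2))
    (hδ : 0 < δ) (hδ1 : δ < 1) (hε : 0 < ε) (hε1 : ε < 1)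
    (hθ : 1 / 2 < θ) (hθ1 : θ < 1) (f : ℝ × ℝ → ℂ) (k : ℝ × ℝ)
    (hk : ¬ (|k.1| ≤ δ / ε ∧ |k.2 / k.1| ≤ δ / ε)) :
    ‖f k‖ₑ ≤ ENNReal.ofReal η * tw θ f k := by
  have h := wgt_small (s := (1 + θ) / 2) (t := (1 - θ) / 2) hδ hδ1 hε hε1 (by linarith)
    (by linarith) (by linarith) k hk
  rw [← hη] at h
  have h2 : wgt (-((1 + θ) / 2)) k * wgt ((1 + θ) / 2) k = 1 := by
    rw [← wgt_add, neg_add_cancel, wgt_zero]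
  unfold tw
  rw [← mul_assoc, ← ENNReal.ofReal_mul ((wgt_pos _ _).le.trans h)]
  have h3 : 1 ≤ ENNReal.ofReal (η * wgt ((1 + θ) / 2) k) := by
    rw [ENNReal.one_le_ofReal]
    exact h2.symm.le.trans (mul_le_mul_of_nonneg_right h (wgt_pos _ _).le)
  calc ‖f k‖ₑ = 1 * ‖f k‖ₑ := (one_mul _).symm
    _ ≤ _ := by gcongr

lemma memLp_of_Y {θ : ℝ} (hθ : 1 / 2 < θ) {f : ℝ × ℝ → ℂ} (hfm : Measurable f)
    (hf : Integrable (fun k => wgt (1 + θ) k * ‖f k‖ ^ 2)) : MemLp f 2 := by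
  rw [memLp_two_iff_integrable_sq_norm hfm.aestronglyMeasurable]
  refine hf.mono' (by fun_prop) (Filter.Eventually.of_forall fun k => ?_)
  rw [Real.norm_of_nonneg (sq_nonneg _)]
  exact le_mul_of_one_le_left (sq_nonneg _) (one_le_wgt (by linarith) k)

lemma chi_measurable (ε δ : ℝ) : Measurable (chiC ε δ) := by
  unfold chiC
  refine Measurable.ite ?_ measurable_const measurable_const
  apply MeasurableSet.inter
  · have h : Measurable fun k : ℝ × ℝ => |k.1| := by fun_prop
    exact measurableSet_le h measurable_const
  · have h : Measurable fun k : ℝ × ℝ => |k.2 / k.1| := by fun_prop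
    exact measurableSet_le h measurable_const

lemma chi_memLp (ε δ : ℝ) {f : ℝ × ℝ → ℂ} (hfm : Measurable f) (hf : MemLp f 2) :
    MemLp (fun j => chiC ε δ j * f j) 2 := by
  refine hf.mono ((chi_measurable ε δ).mul hfm).aestronglyMeasurable
    (Filter.Eventually.of_forall fun k => ?_)
  unfold chiC
  split_ifs <;> simp

lemma conv_integrable {f g : ℝ × ℝ → ℂ} (hf : MemLp f 2) (hg : MemLp g 2) (k : ℝ × ℝ) :
    Integrable (fun j => f j * g (k - j)) := by
  have h := hg.comp_measurePreserving (Measure.measurePreserving_sub_left volume k)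
  exact hf.integrable_mul h

/-- The pointwise bound of the bilinear error. -/
lemma pointwise_bound {ε δ θ η : ℝ} (hη : η = (δ⁻¹) ^ 2 * ε ^ ((1 - θ) / 2))
    (hδ : 0 < δ) (hδ1 : δ < 1) (hε : 0 < ε) (hε1 : ε < 1)
    (hθ : 1 / 2 < θ) (hθ1 : θ < 1) {f g : ℝ × ℝ → ℂ} (hfm : Measurable f) (hgm : Measurable g)
    (hf : Integrable (fun k => wgt (1 + θ) k * ‖f k‖ ^ 2))
    (hg : Integrable (fun k => wgt (1 + θ) k * ‖g k‖ ^ 2)) (k : ℝ × ℝ) :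
    ENNReal.ofReal (wgt (-((1 - θ) / 2)) k) *
      ‖chiC ε δ k * conv (fun j => chiC ε δ j * f j) (fun j => chiC ε δ j * g j) k
            - conv f g k‖ₑ ≤
      ENNReal.ofReal η * ((∫⁻ j, tw θ f j * ‖g (k - j)‖ₑ) + ∫⁻ j, ‖f j‖ₑ * tw θ g (k - j)) := by
  have hf2 := memLp_of_Y hθ hfm hf
  have hg2 := memLp_of_Y hθ hgm hg
  by_cases hk : |k.1| ≤ δ / ε ∧ |k.2 / k.1| ≤ δ / ε
  · have hc : chiC ε δ k = 1 := by unfold chiC; rw [if_pos hk]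
    have hw : ENNReal.ofReal (wgt (-((1 - θ) / 2)) k) ≤ 1 := by
      rw [ENNReal.ofReal_le_one]
      exact Real.rpow_le_one_of_one_le_of_nonpos (wbase_ge_one k) (by linarith)
    rw [hc, one_mul]
    unfold conv
    rw [← integral_sub (conv_integrable (chi_memLp ε δ hfm hf2) (chi_memLp ε δ hgm hg2) k)
      (conv_integrable hf2 hg2 k)]
    refine (mul_le_mul' hw (enorm_integral_le_lintegral_enorm _)).trans ?_
    have htf := tw_measurable θ hfm
    have htg := tw_measurable θ hgm
    rw [one_mul, ← lintegral_add_left (by fun_prop), ← lintegral_const_mul _ (by fun_prop)]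
    apply lintegral_mono
    intro j
    by_cases h1 : |j.1| ≤ δ / ε ∧ |j.2 / j.1| ≤ δ / ε
    · have c1 : chiC ε δ j = 1 := by unfold chiC; rw [if_pos h1]
      by_cases h2 : |(k - j).1| ≤ δ / ε ∧ |(k - j).2 / (k - j).1| ≤ δ / ε
      · have c2 : chiC ε δ (k - j) = 1 := by unfold chiC; rw [if_pos h2]
        simp [c1, c2]
      · have c2 : chiC ε δ (k - j) = 0 := by unfold chiC; rw [if_neg h2]
        have := enorm_le_small_tw hη hδ hδ1 hε hε1 hθ hθ1 g (k - j) h2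
        simp only [c1, c2, zero_mul, mul_zero, zero_sub, enorm_neg, enorm_mul]
        calc ‖f j‖ₑ * ‖g (k - j)‖ₑ ≤ ‖f j‖ₑ * (ENNReal.ofReal η * tw θ g (k - j)) := by gcongr
          _ = ENNReal.ofReal η * (‖f j‖ₑ * tw θ g (k - j)) := by ring
          _ ≤ _ := by gcongr; exact le_add_self
    · have c1 : chiC ε δ j = 0 := by unfold chiC; rw [if_neg h1]
      have := enorm_le_small_tw hη hδ hδ1 hε hε1 hθ hθ1 f j h1
      simp only [c1, zero_mul, zero_sub, enorm_neg, enorm_mul]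
      calc ‖f j‖ₑ * ‖g (k - j)‖ₑ ≤ (ENNReal.ofReal η * tw θ f j) * ‖g (k - j)‖ₑ := by gcongr
        _ = ENNReal.ofReal η * (tw θ f j * ‖g (k - j)‖ₑ) := by ring
        _ ≤ _ := by gcongr; exact le_self_add
  · have hc : chiC ε δ k = 0 := by unfold chiC; rw [if_neg hk]
    have h := wgt_small (s := (1 - θ) / 2) (t := (1 - θ) / 2) hδ hδ1 hε hε1 (by linarith)
      (by linarith) (by linarith) k hk
    rw [← hη] at h
    rw [hc, zero_mul, zero_sub, enorm_neg]
    refine mul_le_mul' (ENNReal.ofReal_le_ofReal h) ?_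
    unfold conv
    refine (enorm_integral_le_lintegral_enorm _).trans ?_
    refine le_trans ?_ le_self_add
    apply lintegral_mono
    intro j
    simp only [enorm_mul]
    gcongr
    exact enorm_le_tw (by linarith) f j

lemma young_tw {θ : ℝ} (hθ : 1 / 2 < θ) {f g : ℝ × ℝ → ℂ} (hfm : Measurable f)
    (hgm : Measurable g)
    (hf : Integrable (fun k => wgt (1 + θ) k * ‖f k‖ ^ 2))
    (hg : Integrable (fun k => wgt (1 + θ) k * ‖g k‖ ^ 2)) :
    ∫⁻ k, (∫⁻ j, ‖f j‖ₑ * tw θ g (k - j)) ^ 2 ≤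
      ENNReal.ofReal (∫ k, wgt (-(1 + θ)) k) * ENNReal.ofReal (YnormSq (1 + θ) f) *
        ENNReal.ofReal (YnormSq (1 + θ) g) := by
  refine (young12 hfm.enorm (tw_measurable θ hgm)).trans ?_
  rw [lintegral_tw_sq θ hg]
  gcongr
  exact lintegral_enorm_sq θ hθ hfm hf

lemma mKP_lower {β : ℝ} (hβ : 1 / 3 < β) :
    ∃ c > (0 : ℝ), ∀ k, c * wgt 1 k ≤ mKP β k := by
  refine ⟨min 1 ((1 / 2) * (β - 1 / 3)), lt_min one_pos (by linarith), fun k => ?_⟩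
  set c := min 1 ((1 / 2) * (β - 1 / 3)) with hc
  have c1 : c ≤ 1 := min_le_left _ _
  have c2 : c ≤ (1 / 2) * (β - 1 / 3) := min_le_right _ _
  unfold wgt mKP
  rw [Real.rpow_one]
  have h1 : 0 ≤ k.1 ^ 2 := sq_nonneg _
  have h2 : 0 ≤ k.2 ^ 2 / k.1 ^ 2 := by positivity
  nlinarith [mul_le_mul_of_nonneg_right c2 h1, mul_le_mul_of_nonneg_right c1 h2]

/-- Combined bilinear estimate:
`|m̃(D)⁻¹(χ_ε(D)((χ_ε(D)ζ)(χ_ε(D)ρ)) - ζρ)|_{Y^{1+θ}} ≲ ε^{(1-θ)/2} |ζ|_{Y^{1+θ}} |ρ|_{Y^{1+θ}}`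
for θ ∈ (1/2,1), stated on the Fourier side with physical-space products expressed as
convolutions. -/
theorem stmt11 (β δ θ : ℝ) (hβ : 1 / 3 < β) (hδ : 0 < δ) (hδ1 : δ < 1)
    (hθ : 1 / 2 < θ) (hθ1 : θ < 1) :
    ∃ C > (0 : ℝ), ∀ ε : ℝ, 0 < ε → ε < 1 → ∀ f g : ℝ × ℝ → ℂ,
      Measurable f → Measurable g →
      Integrable (fun k => wgt (1 + θ) k * ‖f k‖ ^ 2) →
      Integrable (fun k => wgt (1 + θ) k * ‖g k‖ ^ 2) →
      Real.sqrt (YnormSq (1 + θ) (fun k => ((mKP β k : ℝ) : ℂ)⁻¹ *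
          (chiC ε δ k * conv (fun j => chiC ε δ j * f j) (fun j => chiC ε δ j * g j) k
            - conv f g k)))
        ≤ C * ε ^ ((1 - θ) / 2) *
            Real.sqrt (YnormSq (1 + θ) f) * Real.sqrt (YnormSq (1 + θ) g) := by
  obtain ⟨c, hc, hm⟩ := mKP_lower hβ
  set K : ℝ := ∫ k, wgt (-(1 + θ)) k with hK
  have hK0 : 0 ≤ K := integral_nonneg fun k => (wgt_pos _ _).le
  refine ⟨2 * c⁻¹ * (δ⁻¹) ^ 2 * (K + 1), by positivity, ?_⟩
  intro ε hε hε1 f g hfm hgm hf hg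
  set N : ℝ × ℝ → ℂ := fun k =>
    chiC ε δ k * conv (fun j => chiC ε δ j * f j) (fun j => chiC ε δ j * g j) k
            - conv f g k with hN
  set η : ℝ := (δ⁻¹) ^ 2 * ε ^ ((1 - θ) / 2) with hη
  have hη0 : 0 ≤ η := by positivity
  set F := YnormSq (1 + θ) f with hF
  set G := YnormSq (1 + θ) g with hG
  have hF0 : 0 ≤ F := integral_nonneg fun k => mul_nonneg (wgt_pos _ _).le (sq_nonneg _)
  have hG0 : 0 ≤ G := integral_nonneg fun k => mul_nonneg (wgt_pos _ _).le (sq_nonneg _)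
  have htf := tw_measurable θ hfm
  have htg := tw_measurable θ hgm
  -- pointwise bound for the integrand
  have hpt : ∀ k, ENNReal.ofReal ‖wgt (1 + θ) k * ‖((mKP β k : ℝ) : ℂ)⁻¹ * N k‖ ^ 2‖ ≤
      ENNReal.ofReal (c⁻¹ ^ 2 * η ^ 2 * 2) * ((∫⁻ j, tw θ f j * ‖g (k - j)‖ₑ) ^ 2 +
        (∫⁻ j, ‖f j‖ₑ * tw θ g (k - j)) ^ 2) := by
    intro k
    have hb := pointwise_bound hη hδ hδ1 hε hε1 hθ hθ1 hfm hgm hf hg k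
    set A := ∫⁻ j, tw θ f j * ‖g (k - j)‖ₑ
    set B := ∫⁻ j, ‖f j‖ₑ * tw θ g (k - j)
    have hb2 := pow_le_pow_left' hb 2
    have hw1 : 0 < wgt 1 k := wgt_pos _ _
    have hmpos : 0 < mKP β k := lt_of_lt_of_le (by positivity) (hm k)
    have hle : wgt (1 + θ) k * ‖((mKP β k : ℝ) : ℂ)⁻¹ * N k‖ ^ 2 ≤
        c⁻¹ ^ 2 * (wgt (-((1 - θ) / 2)) k * ‖N k‖) ^ 2 := by
      rw [norm_mul, norm_inv, Complex.norm_real, Real.norm_of_nonneg hmpos.le]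
      have hinv : (mKP β k)⁻¹ ≤ c⁻¹ * wgt (-1) k := by
        have e : wgt (-1) k = (wgt 1 k)⁻¹ := by
          rw [eq_comm, inv_eq_iff_eq_inv, eq_comm, inv_eq_of_mul_eq_one_left]
          rw [← wgt_add]
          norm_num [wgt_zero]
        rw [e, ← mul_inv]
        exact inv_anti₀ (by positivity) (hm k)
      have hs : wgt (1 + θ) k * (wgt (-1) k) ^ 2 = wgt (-((1 - θ) / 2)) k ^ 2 := by
        rw [pow_two, pow_two, ← wgt_add, ← wgt_add, ← wgt_add]
        congr 1
        ring
      have hw := (wgt_pos (1 + θ) k).le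
      have hminv : 0 ≤ (mKP β k)⁻¹ := by positivity
      calc wgt (1 + θ) k * ((mKP β k)⁻¹ * ‖N k‖) ^ 2
          ≤ wgt (1 + θ) k * ((c⁻¹ * wgt (-1) k) * ‖N k‖) ^ 2 := by gcongr
        _ = c⁻¹ ^ 2 * (wgt (1 + θ) k * (wgt (-1) k) ^ 2) * ‖N k‖ ^ 2 := by ring
        _ = _ := by rw [hs]; ring
    rw [Real.norm_of_nonneg (mul_nonneg (wgt_pos _ _).le (sq_nonneg _))]
    refine (ENNReal.ofReal_le_ofReal hle).trans ?_
    rw [ENNReal.ofReal_mul (by positivity),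
      ENNReal.ofReal_pow (mul_nonneg (wgt_pos _ _).le (norm_nonneg _)),
      ENNReal.ofReal_mul (wgt_pos _ _).le, ofReal_norm]
    have hAB : (A + B) ^ 2 ≤ 2 * (A ^ 2 + B ^ 2) := by
      have := ENNReal.rpow_add_le_mul_rpow_add_rpow A B (p := 2) one_le_two
      norm_num at this
      exact this
    calc ENNReal.ofReal (c⁻¹ ^ 2) * (ENNReal.ofReal (wgt (-((1 - θ) / 2)) k) * ‖N k‖ₑ) ^ 2
        ≤ ENNReal.ofReal (c⁻¹ ^ 2) * (ENNReal.ofReal η * (A + B)) ^ 2 := by gcongr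
      _ = ENNReal.ofReal (c⁻¹ ^ 2) * ENNReal.ofReal η ^ 2 * (A + B) ^ 2 := by ring
      _ ≤ ENNReal.ofReal (c⁻¹ ^ 2) * ENNReal.ofReal η ^ 2 * (2 * (A ^ 2 + B ^ 2)) := by gcongr
      _ = _ := by
        rw [ENNReal.ofReal_mul (p := c⁻¹ ^ 2 * η ^ 2) (by positivity),
          ENNReal.ofReal_mul (p := c⁻¹ ^ 2) (by positivity), ENNReal.ofReal_pow hη0]
        rw [ENNReal.ofReal_ofNat]
        ring
  have hA : ∫⁻ k, (∫⁻ j, tw θ f j * ‖g (k - j)‖ₑ) ^ 2 ≤ ENNReal.ofReal (K * F * G) := by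
    have e : ∀ k : ℝ × ℝ, ∫⁻ j, tw θ f j * ‖g (k - j)‖ₑ = ∫⁻ j, ‖g j‖ₑ * tw θ f (k - j) := by
      intro k
      rw [← lintegral_sub_left_eq_self (fun j => ‖g j‖ₑ * tw θ f (k - j)) k]
      apply lintegral_congr
      intro j
      rw [sub_sub_cancel, mul_comm]
    simp_rw [e]
    refine (young_tw hθ hgm hfm hg hf).trans (le_of_eq ?_)
    rw [ENNReal.ofReal_mul (by positivity), ENNReal.ofReal_mul hK0]
    ring
  have hB : ∫⁻ k, (∫⁻ j, ‖f j‖ₑ * tw θ g (k - j)) ^ 2 ≤ ENNReal.ofReal (K * F * G) := by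
    refine (young_tw hθ hfm hgm hf hg).trans (le_of_eq ?_)
    rw [ENNReal.ofReal_mul (by positivity), ENNReal.ofReal_mul hK0]
  have hmeasA : Measurable fun k : ℝ × ℝ => (∫⁻ j, tw θ f j * ‖g (k - j)‖ₑ) ^ 2 := by
    apply Measurable.pow_const
    apply Measurable.lintegral_prod_right'
      (f := fun z : (ℝ × ℝ) × (ℝ × ℝ) => tw θ f z.2 * ‖g (z.1 - z.2)‖ₑ)
    fun_prop
  have hmeasB : Measurable fun k : ℝ × ℝ => (∫⁻ j, ‖f j‖ₑ * tw θ g (k - j)) ^ 2 := by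
    apply Measurable.pow_const
    apply Measurable.lintegral_prod_right'
      (f := fun z : (ℝ × ℝ) × (ℝ × ℝ) => ‖f z.2‖ₑ * tw θ g (z.1 - z.2))
    fun_prop
  have hint : ∫⁻ k, ENNReal.ofReal ‖wgt (1 + θ) k * ‖((mKP β k : ℝ) : ℂ)⁻¹ * N k‖ ^ 2‖ ≤
      ENNReal.ofReal (c⁻¹ ^ 2 * η ^ 2 * 2 * (K * F * G + K * F * G)) := by
    refine (lintegral_mono hpt).trans ?_
    rw [lintegral_const_mul _ (by exact hmeasA.add hmeasB), lintegral_add_left hmeasA,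
      ENNReal.ofReal_mul (p := c⁻¹ ^ 2 * η ^ 2 * 2) (by positivity), ENNReal.ofReal_add (by positivity) (by positivity)]
    gcongr
  have hY : YnormSq (1 + θ) (fun k => ((mKP β k : ℝ) : ℂ)⁻¹ * N k) ≤
      c⁻¹ ^ 2 * η ^ 2 * 2 * (K * F * G + K * F * G) := by
    unfold YnormSq
    refine (le_abs_self _).trans ?_
    rw [← Real.norm_eq_abs]
    refine (norm_integral_le_lintegral_norm _).trans ?_
    exact ENNReal.toReal_le_of_le_ofReal (by positivity) hint
  have hfin : 2 * c⁻¹ * (δ⁻¹) ^ 2 * (K + 1) * ε ^ ((1 - θ) / 2) * Real.sqrt F * Real.sqrt G =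
      2 * c⁻¹ * η * (K + 1) * Real.sqrt F * Real.sqrt G := by
    rw [hη]; ring
  rw [hfin]
  apply Real.sqrt_le_iff.mpr
  refine ⟨by positivity, hY.trans ?_⟩
  have e : (2 * c⁻¹ * η * (K + 1) * Real.sqrt F * Real.sqrt G) ^ 2 =
      4 * c⁻¹ ^ 2 * η ^ 2 * (F * G) * (K + 1) ^ 2 := by
    rw [mul_pow, mul_pow, Real.sq_sqrt hF0, Real.sq_sqrt hG0]; ring
  rw [e]
  have : K ≤ (K + 1) ^ 2 := by nlinarith
  calc c⁻¹ ^ 2 * η ^ 2 * 2 * (K * F * G + K * F * G)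
      = 4 * c⁻¹ ^ 2 * η ^ 2 * (F * G) * K := by ring
    _ ≤ _ := by gcongr
end

section
/- With notation as in the FDKP setting (β > 1/3, δ ∈ (0,1) small fixed), the estimate |ε²/(ε² + n_ε(k)) - 1/m̃(k)| ≲ ε (1 + k₁² + k₂²/k₁²)^{-1/2} holds uniformly over k with |k₁| < δ/ε and |k₂/k₁| < δ/ε, where n_ε(k) = n(εk₁, ε²k₂), n = m - 1, and m̃(k) = 1 + k₂²/k₁² + (1/2)(β-1/3)k₁². -/
/-- The FDKP-I dispersion symbol, with `tanh r / r` extended by `1` at `r = 0`. -/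
noncomputable def mFDKP (β : ℝ) (k : ℝ × ℝ) : ℝ :=
  Real.sqrt (1 + β * (k.1 ^ 2 + k.2 ^ 2)) *
  Real.sqrt (if k = 0 then 1 else
    Real.tanh (Real.sqrt (k.1 ^ 2 + k.2 ^ 2)) / Real.sqrt (k.1 ^ 2 + k.2 ^ 2)) *
  Real.sqrt (1 + 2 * k.2 ^ 2 / k.1 ^ 2)

theorem aux_hasDeriv_tanh (x : ℝ) : HasDerivAt Real.tanh (1 - Real.tanh x ^ 2) x := by
  have h := (Real.hasDerivAt_sinh x).div (Real.hasDerivAt_cosh x) (Real.cosh_pos x).ne'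
  have h2 : (Real.sinh / Real.cosh) = Real.tanh := by
    funext y; simp [Real.tanh_eq_sinh_div_cosh]
  rw [h2] at h
  refine h.congr_deriv ?_
  rw [Real.tanh_eq_sinh_div_cosh]
  have := (Real.cosh_pos x).ne'
  field_simp

theorem aux_nonneg (f f' : ℝ → ℝ) (hf : ∀ x, HasDerivAt f (f' x) x) (h0 : f 0 = 0)
    (hp : ∀ x, 0 ≤ x → x ≤ 1 → 0 ≤ f' x) (r : ℝ) (hr : 0 ≤ r) (hr1 : r ≤ 1) : 0 ≤ f r := by
  have hm : MonotoneOn f (Set.Icc 0 1) := by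
    apply monotoneOn_of_deriv_nonneg (convex_Icc 0 1)
    · exact fun x _ => (hf x).continuousAt.continuousWithinAt
    · exact fun x _ => (hf x).differentiableAt.differentiableWithinAt
    · intro x hx
      rw [interior_Icc] at hx
      rw [(hf x).deriv]
      exact hp x hx.1.le hx.2.le
  have := hm (show (0:ℝ) ∈ Set.Icc 0 1 by simp) ⟨hr, hr1⟩ hr
  linarith

theorem aux_tanh (r : ℝ) (hr : 0 ≤ r) (hr1 : r ≤ 1) :
    r - r ^ 3 / 3 ≤ Real.tanh r ∧ Real.tanh r ≤ r - r ^ 3 / 3 + 2 / 15 * r ^ 5 := by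
  have h0 : ∀ x : ℝ, 0 ≤ x → 0 ≤ Real.tanh x := fun x hx => by
    rw [Real.tanh_eq_sinh_div_cosh]
    exact div_nonneg (Real.sinh_nonneg_iff.2 hx) (Real.cosh_pos x).le
  have h1 : ∀ x : ℝ, 0 ≤ x → x ≤ 1 → 0 ≤ x - Real.tanh x := by
    refine aux_nonneg (fun x => x - Real.tanh x) (fun x => 1 - (1 - Real.tanh x ^ 2)) ?_ ?_ ?_
    · exact fun x => (hasDerivAt_id x).sub (aux_hasDeriv_tanh x)
    · simp
    · intro x _ _
      nlinarith [sq_nonneg (Real.tanh x)]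
  have h2 : ∀ x : ℝ, 0 ≤ x → x ≤ 1 → 0 ≤ Real.tanh x - (x - x ^ 3 / 3) := by
    refine aux_nonneg (fun x => Real.tanh x - (x - x ^ 3 / 3))
      (fun x => (1 - Real.tanh x ^ 2) - (1 - x ^ 2)) ?_ ?_ ?_
    · intro x
      refine (aux_hasDeriv_tanh x).sub ?_
      refine ((hasDerivAt_id x).sub ((hasDerivAt_pow 3 x).div_const 3)).congr_deriv ?_
      norm_num
    · simp
    · intro x hx hx1
      nlinarith [h0 x hx, h1 x hx hx1]
  have h3 : ∀ x : ℝ, 0 ≤ x → x ≤ 1 → 0 ≤ (x - x ^ 3 / 3 + 2 / 15 * x ^ 5) - Real.tanh x := by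
    refine aux_nonneg (fun x => (x - x ^ 3 / 3 + 2 / 15 * x ^ 5) - Real.tanh x)
      (fun x => (1 - x ^ 2 + 2 / 3 * x ^ 4) - (1 - Real.tanh x ^ 2)) ?_ ?_ ?_
    · intro x
      refine HasDerivAt.sub ?_ (aux_hasDeriv_tanh x)
      refine (((hasDerivAt_id x).sub ((hasDerivAt_pow 3 x).div_const 3)).add
        ((hasDerivAt_pow 5 x).const_mul (2 / 15))).congr_deriv ?_
      norm_num
      ring
    · simp
    · intro x hx hx1
      have ha : 0 ≤ x - x ^ 3 / 3 := by
        have : x ^ 3 ≤ x := pow_le_of_le_one hx hx1 (by norm_num)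
        linarith
      have hb : (x - x ^ 3 / 3) ^ 2 ≤ Real.tanh x ^ 2 :=
        pow_le_pow_left₀ ha (by linarith [h2 x hx hx1]) 2
      have hc : 0 ≤ x ^ 6 := by positivity
      nlinarith
  exact ⟨by linarith [h2 r hr hr1], by linarith [h3 r hr hr1]⟩

set_option maxHeartbeats 1000000 in
/-- Expansion of the symbol in the variables `a = s₁`, `b = s₂/s₁`. -/
theorem aux_symbol (β : ℝ) (hβ : 1 / 3 < β) (a b : ℝ) (ha : a ≠ 0) (ha2 : a ^ 2 ≤ 1 / 2)
    (hb2 : b ^ 2 ≤ 1 / 2) :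
    |mFDKP β (a, a * b) - 1 - (1 / 2 * (β - 1 / 3) * a ^ 2 + b ^ 2)| ≤
      (32 * β + 12 + (β + 1) ^ 2) * (a ^ 2 + b ^ 2) ^ 2 := by
  have hne : ((a, a * b) : ℝ × ℝ) ≠ 0 := by
    intro h; exact ha (by simpa using congrArg Prod.fst h)
  have hu : 0 < a ^ 2 := by positivity
  have hv : 0 ≤ b ^ 2 := by positivity
  have e1 : a ^ 2 + (a * b) ^ 2 = a ^ 2 * (1 + b ^ 2) := by ring
  have e2 : 2 * (a * b) ^ 2 / a ^ 2 = 2 * b ^ 2 := by field_simp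
  unfold mFDKP
  simp only [if_neg hne, e1, e2]
  generalize a ^ 2 = u at *
  generalize b ^ 2 = v at *
  obtain ⟨ρ, hρ⟩ : ∃ ρ, ρ = u * (1 + v) := ⟨_, rfl⟩
  rw [← hρ]
  have hρ0 : 0 < ρ := by rw [hρ]; positivity
  have hρ1 : ρ ≤ 1 := by rw [hρ]; nlinarith
  have hρw : ρ ≤ 2 * (u + v) := by rw [hρ]; nlinarith
  obtain ⟨r, hr⟩ : ∃ r, r = Real.sqrt ρ := ⟨_, rfl⟩
  rw [← hr]
  have hr0 : 0 < r := by rw [hr]; exact Real.sqrt_pos.2 hρ0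
  have hrr : r ^ 2 = ρ := by rw [hr]; exact Real.sq_sqrt hρ0.le
  have hr1 : r ≤ 1 := by nlinarith
  obtain ⟨t1, t2⟩ := aux_tanh r hr0.le hr1
  obtain ⟨e, he⟩ : ∃ e, Real.tanh r / r = 1 - ρ / 3 + e := ⟨Real.tanh r / r - (1 - ρ / 3), by ring⟩
  have he0 : 0 ≤ e := by
    have : 1 - ρ / 3 ≤ Real.tanh r / r := by
      rw [le_div_iff₀ hr0, ← hrr]; linarith
    linarith
  have he1 : e ≤ ρ ^ 2 := by
    have : Real.tanh r / r ≤ 1 - ρ / 3 + 2 / 15 * ρ ^ 2 := by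
      rw [div_le_iff₀ hr0, ← hrr]; linarith
    nlinarith
  rw [he]
  have hT : 0 ≤ 1 - ρ / 3 + e := by linarith
  have hβ0 : 0 < β := by linarith
  rw [← Real.sqrt_mul (by positivity), ← Real.sqrt_mul (by positivity)]
  obtain ⟨w, hw⟩ : ∃ w, w = u + v := ⟨_, rfl⟩
  rw [← hw] at hρw ⊢
  have hw0 : 0 < w := by linarith
  have hρ2 : ρ ^ 2 ≤ 4 * w ^ 2 := by nlinarith
  have huv : u * v ≤ w ^ 2 := by rw [hw]; nlinarith
  have huv0 : 0 ≤ u * v := by positivity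
  have hρe : ρ * e ≤ 4 * w ^ 2 := by nlinarith
  have hρe0 : 0 ≤ ρ * e := by positivity
  obtain ⟨x, hx⟩ : ∃ x, x = (β - 1 / 3) * (u * v) + e - β * ρ ^ 2 / 3 + β * (ρ * e) := ⟨_, rfl⟩
  have q1 : (β - 1 / 3) * (u * v) ≤ β * w ^ 2 := by nlinarith
  have q1' : 0 ≤ (β - 1 / 3) * (u * v) := mul_nonneg (by linarith) huv0
  have q2 : β * ρ ^ 2 ≤ β * (4 * w ^ 2) := by gcongr
  have q3 : β * (ρ * e) ≤ β * (4 * w ^ 2) := by gcongr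
  have q2' : 0 ≤ β * ρ ^ 2 := by positivity
  have q3' : 0 ≤ β * (ρ * e) := by positivity
  have q4 : 0 ≤ β * w ^ 2 := by positivity
  have hxa : |x| ≤ (10 * β + 4) * w ^ 2 := by
    rw [abs_le]; constructor <;> rw [hx] <;> linarith
  obtain ⟨P, hP⟩ : ∃ P, P = 1 / 2 * (β - 1 / 3) * u + v := ⟨_, rfl⟩
  obtain ⟨M, hM⟩ : ∃ M, M = (1 + β * ρ) * (1 - ρ / 3 + e) * (1 + 2 * v) := ⟨_, rfl⟩
  rw [← hP, ← hM]
  have hM0 : 0 ≤ M := by rw [hM]; positivity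
  have hMP : M - (1 + 2 * P) = 2 * ((β - 1 / 3) * (u * v)) + x * (1 + 2 * v) := by
    rw [hM, hP, hx, hρ]; ring
  have hMa : |M - (1 + 2 * P)| ≤ (32 * β + 12) * w ^ 2 := by
    rw [hMP]
    have : |x * (1 + 2 * v)| ≤ (10 * β + 4) * w ^ 2 * 3 := by
      rw [abs_mul, abs_of_pos (by linarith : 0 < 1 + 2 * v)]
      apply mul_le_mul hxa (by linarith) (by linarith) (by positivity)
    rw [abs_le] at this ⊢
    constructor <;> linarith
  have hP0 : 0 ≤ P := by
    rw [hP]; have := mul_nonneg (by linarith : 0 ≤ β - 1 / 3) hu.le; linarith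
  have hPw : P ≤ (β + 1) * w := by rw [hP, hw]; nlinarith
  have hP2 : P ^ 2 ≤ (β + 1) ^ 2 * w ^ 2 := by
    rw [← mul_pow]; exact pow_le_pow_left₀ hP0 hPw 2
  have hs := Real.sq_sqrt hM0
  have hs0 := Real.sqrt_nonneg M
  generalize Real.sqrt M = m at *
  have h1 : |m - 1 - P| * (m + 1 + P) = |M - (1 + 2 * P) - P ^ 2| := by
    rw [← abs_of_nonneg (by linarith : 0 ≤ m + 1 + P), ← abs_mul,
      ← hs]
    congr 1; ring
  have h2 : |m - 1 - P| ≤ |m - 1 - P| * (m + 1 + P) :=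
    le_mul_of_one_le_right (abs_nonneg _) (by linarith)
  have h3 := abs_sub (M - (1 + 2 * P)) (P ^ 2)
  rw [abs_of_nonneg (sq_nonneg P)] at h3
  linarith

theorem aux_final (K c ε p q n : ℝ) (hK : 0 < K) (hc : 0 < c) (hε : 0 < ε) (hq : 0 ≤ q)
    (hp : c * q ≤ p) (hw : ε ^ 2 * q ≤ 2) (hKw : K * (ε ^ 2 * q) ≤ c / 2)
    (hn : |n - ε ^ 2 * p| ≤ K * (ε ^ 2 * q) ^ 2) (hε1 : ε < 1) :
    |ε ^ 2 / (ε ^ 2 + n) - (1 + p)⁻¹| ≤ (4 * K / c ^ 2) * ε / Real.sqrt (1 + q) := by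
  have hε2 : 0 < ε ^ 2 := by positivity
  have hcq : 0 ≤ c * q := by positivity
  have hnl : ε ^ 2 * (c / 2 * q) ≤ n := by
    have h1 := (abs_le.1 hn).1
    have h2 : K * (ε ^ 2 * q) ^ 2 ≤ c / 2 * (ε ^ 2 * q) := by
      rw [sq, ← mul_assoc]; exact mul_le_mul_of_nonneg_right hKw (by positivity)
    have h3 : ε ^ 2 * (c * q) ≤ ε ^ 2 * p := by gcongr
    nlinarith
  have hn0 : 0 ≤ n := le_trans (by positivity) hnl
  have hd : 0 < ε ^ 2 + n := by linarith
  have hp1 : 0 < 1 + p := by linarith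
  have e1 : ε ^ 2 / (ε ^ 2 + n) - (1 + p)⁻¹ = - (n - ε ^ 2 * p) / ((ε ^ 2 + n) * (1 + p)) := by
    field_simp; ring
  have h1 : |ε ^ 2 / (ε ^ 2 + n) - (1 + p)⁻¹| ≤ 2 * K / c ^ 2 * ε ^ 2 := by
    rw [e1, abs_div, abs_neg, abs_of_pos (mul_pos hd hp1), div_le_iff₀ (mul_pos hd hp1)]
    refine hn.trans ?_
    have h4 : (ε ^ 2 * (c / 2 * q)) * (c * q) ≤ (ε ^ 2 + n) * (1 + p) :=
      mul_le_mul (by linarith) (by linarith) hcq hd.le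
    calc K * (ε ^ 2 * q) ^ 2 = 2 * K / c ^ 2 * ε ^ 2 * ((ε ^ 2 * (c / 2 * q)) * (c * q)) := by
          field_simp
      _ ≤ _ := by gcongr
  refine h1.trans ?_
  have hs : 0 < Real.sqrt (1 + q) := Real.sqrt_pos.2 (by linarith)
  rw [le_div_iff₀ hs]
  have h5 : ε * Real.sqrt (1 + q) ≤ 2 := by
    refine abs_le_of_sq_le_sq' ?_ (by norm_num) |>.2
    rw [mul_pow, Real.sq_sqrt (by linarith)]
    nlinarith
  calc 2 * K / c ^ 2 * ε ^ 2 * Real.sqrt (1 + q)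
      = 2 * K / c ^ 2 * ε * (ε * Real.sqrt (1 + q)) := by ring
    _ ≤ 2 * K / c ^ 2 * ε * 2 := by gcongr
    _ = _ := by ring

/-- `|ε²/(ε² + n_ε(k)) - 1/m̃(k)| ≲ ε (1 + k₁² + k₂²/k₁²)^{-1/2}` uniformly over the
cone `|k₁| < δ/ε`, `|k₂/k₁| < δ/ε`, where `n_ε(k) = n(εk₁, ε²k₂)` and `n = m - 1`. -/
theorem stmt16 (β : ℝ) (hβ : 1 / 3 < β) :
    ∃ δ : ℝ, 0 < δ ∧ δ < 1 ∧ ∃ C > (0 : ℝ), ∀ ε : ℝ, 0 < ε → ε < 1 →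
      ∀ k : ℝ × ℝ, k.1 ≠ 0 → |k.1| < δ / ε → |k.2 / k.1| < δ / ε →
      |ε ^ 2 / (ε ^ 2 + (mFDKP β (ε * k.1, ε ^ 2 * k.2) - 1)) - (mKP β k)⁻¹| ≤
        C * ε / Real.sqrt (1 + k.1 ^ 2 + k.2 ^ 2 / k.1 ^ 2) := by
  have hγ : 0 < β - 1 / 3 := by linarith
  obtain ⟨K, hKd⟩ : ∃ K, K = 32 * β + 12 + (β + 1) ^ 2 := ⟨_, rfl⟩
  have hK : 0 < K := by rw [hKd]; nlinarith [sq_nonneg (β + 1)]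
  obtain ⟨c, hcd⟩ : ∃ c, c = min (1 / 2 * (β - 1 / 3)) 1 := ⟨_, rfl⟩
  have hc : 0 < c := by rw [hcd]; exact lt_min (by linarith) one_pos
  have hc1 : c ≤ 1 / 2 * (β - 1 / 3) := hcd ▸ min_le_left _ _
  have hc2 : c ≤ 1 := hcd ▸ min_le_right _ _
  obtain ⟨δ, hδd⟩ : ∃ δ, δ = min (1 / 2) (c / (2 * K)) := ⟨_, rfl⟩
  have hδ : 0 < δ := by rw [hδd]; exact lt_min (by norm_num) (by positivity)
  have hδ1 : δ ≤ 1 / 2 := hδd ▸ min_le_left _ _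
  have hδ2 : δ ≤ c / (2 * K) := hδd ▸ min_le_right _ _
  refine ⟨δ, hδ, by linarith, 4 * K / c ^ 2, by positivity, ?_⟩
  rintro ε hε hε1 ⟨k1, k2⟩ hk h1 h2
  simp only at hk h1 h2 ⊢
  rw [lt_div_iff₀ hε] at h1 h2
  obtain ⟨l, hl⟩ : ∃ l, l = k2 / k1 := ⟨_, rfl⟩
  have hk2 : k2 = k1 * l := by rw [hl]; field_simp
  rw [← hl] at h2
  have hll : k2 ^ 2 / k1 ^ 2 = l ^ 2 := by rw [hl, div_pow]
  have ha : (ε * k1) ^ 2 ≤ δ ^ 2 := by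
    rw [← sq_abs, abs_mul, abs_of_pos hε]
    exact pow_le_pow_left₀ (by positivity) (by linarith) 2
  have hb : (ε * l) ^ 2 ≤ δ ^ 2 := by
    rw [← sq_abs, abs_mul, abs_of_pos hε]
    exact pow_le_pow_left₀ (by positivity) (by linarith) 2
  have hδδ : δ ^ 2 ≤ δ / 2 := by nlinarith
  have hsym := aux_symbol β hβ (ε * k1) (ε * l) (mul_ne_zero hε.ne' hk) (by linarith) (by linarith)
  have e1 : ε * k1 * (ε * l) = ε ^ 2 * k2 := by rw [hk2]; ring
  rw [e1, ← hKd] at hsym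
  have hw : ε ^ 2 * (k1 ^ 2 + l ^ 2) ≤ δ := by nlinarith
  have := aux_final K c ε (1 / 2 * (β - 1 / 3) * k1 ^ 2 + l ^ 2) (k1 ^ 2 + l ^ 2)
    (mFDKP β (ε * k1, ε ^ 2 * k2) - 1) hK hc hε (by positivity)
    (by nlinarith [sq_nonneg k1, sq_nonneg l]) (by linarith)
    (by
      rw [le_div_iff₀ (by positivity)] at hδ2
      have := mul_le_mul_of_nonneg_left hw hK.le
      linarith)
    (by
      convert hsym using 2
      · ring
      · ring) hε1
  have e2 : mKP β (k1, k2) = 1 + (1 / 2 * (β - 1 / 3) * k1 ^ 2 + l ^ 2) := by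
    unfold mKP; simp only [hll]; ring
  rw [e2, hll, add_assoc 1 (k1 ^ 2)]
  exact this
end
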